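/- Let (J, ·, α) be a finite-dimensional multiplicative Hom-Jordan superalgebra with α invertible, (V, π, β) a finite-dimensional representation with β invertible, and T : V → J an even linear map with T ∘ β = α ∘ T, regarded via Hom(V, J) ≅ J ⊗ V* as an element T ∈ J ⊗ V* ⊂ (J ⋉_{π⋆} V*) ⊗ (J ⋉_{π⋆} V*). Then r = T − σ(T) is a super skew-symmetric solution of the super Hom-Jordan Yang-Baxter equation in the semi-direct product Hom-Jordan superalgebra J ⋉_{π⋆} V* (formed with the dual representation (V*, π⋆, (β⁻¹)*)) if and only if T is an O-operator on J associated to (V, π, β). -/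

import Mathlib

open scoped TensorProduct

noncomputable section

/-- The sign `(-1)^e` attached to a parity `e : ZMod 2`. -/
def gsign (K : Type*) [Field K] (e : ZMod 2) : K := (-1 : K) ^ e.val

variable {K : Type*} [Field K] [CharZero K]
variable {J V : Type*} [AddCommGroup J] [Module K J] [AddCommGroup V] [Module K V]

/-- An even bilinear map with respect to a `ZMod 2`-grading. -/
def EvenBilin (g : ZMod 2 → Submodule K J) (m : J →ₗ[K] J →ₗ[K] J) : Prop :=
  ∀ i j : ZMod 2, ∀ x ∈ g i, ∀ y ∈ g j, m x y ∈ g (i + j)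

/-- An even linear map with respect to a `ZMod 2`-grading. -/
def EvenMap (g : ZMod 2 → Submodule K J) (α : J →ₗ[K] J) : Prop :=
  ∀ i : ZMod 2, ∀ x ∈ g i, α x ∈ g i

/-- Super-commutativity `x·y = (-1)^{|x||y|} y·x` on homogeneous elements. -/
def SuperComm (g : ZMod 2 → Submodule K J) (m : J →ₗ[K] J →ₗ[K] J) : Prop :=
  ∀ i j : ZMod 2, ∀ x ∈ g i, ∀ y ∈ g j, m x y = gsign K (i * j) • m y x

/-- The Hom-associator `as_α(x,y,z) = (x·y)·α(z) − α(x)·(y·z)`. -/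
def hAss (m : J →ₗ[K] J →ₗ[K] J) (α : J →ₗ[K] J) (x y z : J) : J :=
  m (m x y) (α z) - m (α x) (m y z)

/-- The Hom-Jordan super-identity: the cyclic sum over `(x,y,u)` of
`(-1)^{|u|(|x|+|z|)} as_α(x·y, α(z), α(u))` vanishes. -/
def HomJordanId (g : ZMod 2 → Submodule K J) (m : J →ₗ[K] J →ₗ[K] J) (α : J →ₗ[K] J) : Prop :=
  ∀ px py pz pu : ZMod 2, ∀ x ∈ g px, ∀ y ∈ g py, ∀ z ∈ g pz, ∀ u ∈ g pu,
      gsign K (pu * (px + pz)) • hAss m α (m x y) (α z) (α u)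
    + gsign K (px * (py + pz)) • hAss m α (m y u) (α z) (α x)
    + gsign K (py * (pu + pz)) • hAss m α (m u x) (α z) (α y) = 0

/-- Hom-Jordan superalgebra. -/
def IsHomJordan (g : ZMod 2 → Submodule K J) (m : J →ₗ[K] J →ₗ[K] J) (α : J →ₗ[K] J) : Prop :=
  EvenBilin g m ∧ EvenMap g α ∧ SuperComm g m ∧ HomJordanId g m α

/-- `α` is multiplicative with respect to `m`. -/
def IsMult (m : J →ₗ[K] J →ₗ[K] J) (α : J →ₗ[K] J) : Prop :=
  ∀ x y : J, α (m x y) = m (α x) (α y)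

/-- Multiplicative Hom-Jordan superalgebra. -/
def IsMultHomJordan (g : ZMod 2 → Submodule K J) (m : J →ₗ[K] J →ₗ[K] J) (α : J →ₗ[K] J) :
    Prop :=
  IsHomJordan g m α ∧ IsMult m α

/-- Evenness of a representation map. -/
def EvenRepMap (g : ZMod 2 → Submodule K J) (gV : ZMod 2 → Submodule K V)
    (π : J →ₗ[K] Module.End K V) : Prop :=
  ∀ i j : ZMod 2, ∀ x ∈ g i, ∀ v ∈ gV j, π x v ∈ gV (i + j)

/-- Representation (module) of a Hom-Jordan superalgebra. -/
def IsRep (g : ZMod 2 → Submodule K J) (m : J →ₗ[K] J →ₗ[K] J) (α : J →ₗ[K] J)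
    (gV : ZMod 2 → Submodule K V) (π : J →ₗ[K] Module.End K V) (β : Module.End K V) : Prop :=
  EvenRepMap g gV π ∧ (∀ i : ZMod 2, ∀ v ∈ gV i, β v ∈ gV i) ∧
  (∀ x : J, β * π x = π (α x) * β) ∧
  (∀ px py pz : ZMod 2, ∀ x ∈ g px, ∀ y ∈ g py, ∀ z ∈ g pz,
      gsign K (px * pz) • (π (m (α x) (α y)) * π (α z) * β)
    + gsign K (px * py) • (π (m (α y) (α z)) * π (α x) * β)
    + gsign K (py * pz) • (π (m (α z) (α x)) * π (α y) * β)
    = gsign K (px * pz) • (π (α (α x)) * π (m y z) * β)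
    + gsign K (px * py) • (π (α (α y)) * π (m z x) * β)
    + gsign K (py * pz) • (π (α (α z)) * π (m x y) * β)) ∧
  (∀ px py pz : ZMod 2, ∀ x ∈ g px, ∀ y ∈ g py, ∀ z ∈ g pz,
      gsign K (px * pz) • (π (m (α x) (α y)) * π (α z) * β)
    + gsign K (px * py) • (π (m (α y) (α z)) * π (α x) * β)
    + gsign K (py * pz) • (π (m (α z) (α x)) * π (α y) * β)
    = gsign K (px * pz) • (π (α (α x)) * π (α y) * π z)
    + gsign K (px * py + py * pz) • (π (α (α z)) * π (α y) * π x)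
    + gsign K (py * pz + px * pz) • (π (m (m x z) (α y)) * (β * β)))

/-- O-operator on `J` associated to the representation `(V, π, β)`. -/
def IsOOperator (g : ZMod 2 → Submodule K J) (m : J →ₗ[K] J →ₗ[K] J) (α : J →ₗ[K] J)
    (gV : ZMod 2 → Submodule K V) (π : J →ₗ[K] Module.End K V) (β : Module.End K V)
    (T : V →ₗ[K] J) : Prop :=
  (∀ i : ZMod 2, ∀ v ∈ gV i, T v ∈ g i) ∧
  (∀ v : V, α (T v) = T (β v)) ∧
  (∀ i j : ZMod 2, ∀ u ∈ gV i, ∀ v ∈ gV j,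
    m (T u) (T v) = T (π (T u) v + gsign K (i * j) • π (T v) u))

/-- The grading on a direct sum `J ⊕ V`. -/
def prodGrading (g : ZMod 2 → Submodule K J) (gV : ZMod 2 → Submodule K V) :
    ZMod 2 → Submodule K (J × V) := fun i => (g i).prod (gV i)

/-- The semidirect product multiplication, determined on homogeneous elements. -/
def IsSemidirectMul (g : ZMod 2 → Submodule K J) (gV : ZMod 2 → Submodule K V)
    (m : J →ₗ[K] J →ₗ[K] J) (π : J →ₗ[K] Module.End K V)
    (m' : (J × V) →ₗ[K] (J × V) →ₗ[K] (J × V)) : Prop :=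
  ∀ i j : ZMod 2, ∀ x ∈ g i, ∀ u ∈ gV i, ∀ y ∈ g j, ∀ v ∈ gV j,
    m' (x, u) (y, v) = (m x y, π x v + gsign K (i * j) • π y u)

/-- The induced grading on the linear dual. -/
def dualGrading (gV : ZMod 2 → Submodule K V) (i : ZMod 2) :
    Submodule K (Module.Dual K V) where
  carrier := {ξ | ∀ x ∈ gV (i + 1), ξ x = 0}
  add_mem' := by
    intro a b ha hb x hx
    simp [ha x hx, hb x hx]
  zero_mem' := by
    intro x hx
    simp
  smul_mem' := by
    intro c a ha x hx
    simp [ha x hx]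

/-- Nijenhuis operator on a Hom-Jordan superalgebra. -/
def IsNijenhuis (gA : ZMod 2 → Submodule K J) (mA : J →ₗ[K] J →ₗ[K] J)
    (γ N : J →ₗ[K] J) : Prop :=
  EvenMap gA N ∧ N ∘ₗ γ = γ ∘ₗ N ∧
  ∀ x y : J, mA (N x) (N y) = N (mA (N x) y + mA x (N y) - N (mA x y))

/-- The super-symmetrized product `x·y = x∘y + (-1)^{|x||y|} y∘x` on homogeneous
elements of parities `i`, `j`. -/
def sMul (c : J →ₗ[K] J →ₗ[K] J) (i j : ZMod 2) (x y : J) : J :=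
  c x y + gsign K (i * j) • c y x

/-- Hom-pre-Jordan superalgebra. -/
def IsHomPreJordan (g : ZMod 2 → Submodule K J) (c : J →ₗ[K] J →ₗ[K] J) (α : J →ₗ[K] J) :
    Prop :=
  EvenBilin g c ∧ EvenMap g α ∧ IsMult c α ∧
  (∀ px py pz pu : ZMod 2, ∀ x ∈ g px, ∀ y ∈ g py, ∀ z ∈ g pz, ∀ u ∈ g pu,
      c (sMul c px py (α x) (α y)) (c (α z) (α u))
    + gsign K (px * (py + pz)) • c (sMul c py pz (α y) (α z)) (c (α x) (α u))
    + gsign K (pz * (px + py)) • c (sMul c pz px (α z) (α x)) (c (α y) (α u))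
    = c (α (α x)) (c (sMul c py pz y z) (α u))
    + gsign K (px * (py + pz)) • c (α (α y)) (c (sMul c pz px z x) (α u))
    + gsign K (pz * (px + py)) • c (α (α z)) (c (sMul c px py x y) (α u))) ∧
  (∀ px py pz pu : ZMod 2, ∀ x ∈ g px, ∀ y ∈ g py, ∀ z ∈ g pz, ∀ u ∈ g pu,
      c (α (α x)) (c (α y) (c z u))
    + gsign K (pz * (px + py) + px * py) • c (α (α z)) (c (α y) (c x u))
    + gsign K (py * pz) • c (sMul c (px + pz) py (sMul c px pz x z) (α y)) (α (α u))
    = c (α (α x)) (c (sMul c py pz y z) (α u))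
    + gsign K (px * (py + pz)) • c (α (α y)) (c (sMul c pz px z x) (α u))
    + gsign K (pz * (px + py)) • c (α (α z)) (c (sMul c px py x y) (α u)))

/-- Hom-dendriform superalgebra, with `p = ≺` and `s = ≻`. -/
def IsHomDendriform (g : ZMod 2 → Submodule K J)
    (p s : J →ₗ[K] J →ₗ[K] J) (α : J →ₗ[K] J) : Prop :=
  EvenBilin g p ∧ EvenBilin g s ∧ EvenMap g α ∧ IsMult p α ∧ IsMult s α ∧
  (∀ x y z : J, s (α x) (s y z) = s (p x y + s x y) (α z)) ∧
  (∀ x y z : J, p (p x y) (α z) = p (α x) (p y z + s y z)) ∧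
  (∀ x y z : J, p (s x y) (α z) = s (α x) (p y z))

/-- Hom-alternative superalgebra. -/
def IsHomAlternative (g : ZMod 2 → Submodule K J) (m : J →ₗ[K] J →ₗ[K] J)
    (α : J →ₗ[K] J) : Prop :=
  EvenBilin g m ∧ EvenMap g α ∧
  (∀ i j : ZMod 2, ∀ x ∈ g i, ∀ y ∈ g j, ∀ z : J,
    hAss m α x y z = -(gsign K (i * j) • hAss m α y x z)) ∧
  (∀ j k : ZMod 2, ∀ y ∈ g j, ∀ z ∈ g k, ∀ x : J,
    hAss m α x y z = -(gsign K (j * k) • hAss m α x z y))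

/-- `ass_l` for a Hom-pre-alternative superalgebra, `p = ≺`, `s = ≻`. -/
def passL (p s : J →ₗ[K] J →ₗ[K] J) (α : J →ₗ[K] J) (x y z : J) : J :=
  s (p x y + s x y) (α z) - s (α x) (s y z)

/-- `ass_m` for a Hom-pre-alternative superalgebra. -/
def passM (p s : J →ₗ[K] J →ₗ[K] J) (α : J →ₗ[K] J) (x y z : J) : J :=
  p (s x y) (α z) - s (α x) (p y z)

/-- `ass_r` for a Hom-pre-alternative superalgebra. -/
def passR (p s : J →ₗ[K] J →ₗ[K] J) (α : J →ₗ[K] J) (x y z : J) : J :=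
  p (p x y) (α z) - p (α x) (p y z + s y z)

/-- Hom-pre-alternative superalgebra. -/
def IsHomPreAlternative (g : ZMod 2 → Submodule K J)
    (p s : J →ₗ[K] J →ₗ[K] J) (α : J →ₗ[K] J) : Prop :=
  EvenBilin g p ∧ EvenBilin g s ∧ EvenMap g α ∧
  (∀ i j : ZMod 2, ∀ x ∈ g i, ∀ y ∈ g j, ∀ z : J,
    passM p s α x y z + gsign K (i * j) • passR p s α y x z = 0) ∧
  (∀ j k : ZMod 2, ∀ y ∈ g j, ∀ z ∈ g k, ∀ x : J,
    passM p s α x y z + gsign K (j * k) • passL p s α x z y = 0) ∧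
  (∀ i j : ZMod 2, ∀ x ∈ g i, ∀ y ∈ g j, ∀ z : J,
    passL p s α x y z + gsign K (i * j) • passL p s α y x z = 0) ∧
  (∀ j k : ZMod 2, ∀ y ∈ g j, ∀ z ∈ g k, ∀ x : J,
    passR p s α x y z + gsign K (j * k) • passR p s α x z y = 0)

/-- `r = Σ Xₗ ⊗ Yₗ` (with `Xₗ, Yₗ` homogeneous of parities `Pₗ, Qₗ`) is
super skew-symmetric: `σ(r) = -r`. -/
def SkewSol {ι : Type*} [Fintype ι] {A : Type*} [AddCommGroup A] [Module K A]
    (X Y : ι → A) (P Q : ι → ZMod 2) : Prop :=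
  (∑ l, gsign K (P l * Q l) • (Y l ⊗ₜ[K] X l)) = -(∑ l, X l ⊗ₜ[K] Y l)

/-- `r = Σ Xₗ ⊗ Yₗ` solves the super Hom-Jordan Yang-Baxter equation
`r₁₂·r₁₃ − r₁₂·r₂₃ + r₁₃·r₂₃ = 0`. -/
def YBESol {ι : Type*} [Fintype ι] {A : Type*} [AddCommGroup A] [Module K A]
    (mA : A →ₗ[K] A →ₗ[K] A) (γ : A →ₗ[K] A) (X Y : ι → A) (P Q : ι → ZMod 2) : Prop :=
  (∑ l, ∑ l', gsign K (P l' * Q l) • ((mA (X l) (X l') ⊗ₜ[K] γ (Y l)) ⊗ₜ[K] γ (Y l')))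
    - (∑ l, ∑ l', (γ (X l) ⊗ₜ[K] mA (Y l) (X l')) ⊗ₜ[K] γ (Y l'))
    + (∑ l, ∑ l', gsign K (P l' * Q l) • ((γ (X l) ⊗ₜ[K] γ (X l')) ⊗ₜ[K] mA (Y l) (Y l')))
    = 0

/-- The left components of the family representing `r = T − σ(T)` in
`(J ⋉ V*) ⊗ (J ⋉ V*)`, for `T` regarded in `J ⊗ V*` via a homogeneous basis. -/
def rX {n : ℕ} (T : V →ₗ[K] J) (b : Module.Basis (Fin n) K V) (pe : Fin n → ZMod 2) :
    Fin n ⊕ Fin n → J × Module.Dual K V :=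
  Sum.elim (fun k => (T (b k), 0))
    (fun k => -(gsign K (pe k * pe k)) • ((0 : J), b.coord k))

/-- The right components of the family representing `r = T − σ(T)`. -/
def rY {n : ℕ} (T : V →ₗ[K] J) (b : Module.Basis (Fin n) K V) :
    Fin n ⊕ Fin n → J × Module.Dual K V :=
  Sum.elim (fun k => ((0 : J), b.coord k)) (fun k => (T (b k), 0))

/-- The parities of the family representing `r = T − σ(T)`. -/
def rP {n : ℕ} (pe : Fin n → ZMod 2) : Fin n ⊕ Fin n → ZMod 2 := Sum.elim pe pe

set_option linter.unusedSectionVars false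
set_option linter.unusedSimpArgs false
theorem gs_zero : gsign K 0 = 1 := by simp [gsign]
theorem gs_one : gsign K 1 = -1 := by simp [gsign, ZMod.val_one]
theorem zmod2_cases (a : ZMod 2) : a = 0 ∨ a = 1 := by revert a; decide
theorem zmod2_ne (a i : ZMod 2) : a ≠ i → a = i + 1 := by revert a i; decide
theorem zmod2_ne_succ (i : ZMod 2) : i ≠ i + 1 := by revert i; decide
theorem tns {M N : Type*} [AddCommGroup M] [Module K M] [AddCommGroup N] [Module K N]
    (a : K) (x : M ⊗[K] N) : (-a) • x = -(a • x) := neg_smul a x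
theorem tsn {ι M N : Type*} [Fintype ι] [AddCommGroup M] [Module K M] [AddCommGroup N]
    [Module K N] (x : ι → M ⊗[K] N) : ∑ k, -(x k) = -∑ k, x k := by
  rw [eq_neg_iff_add_eq_zero, ← Finset.sum_add_distrib]
  exact Finset.sum_eq_zero fun k _ => neg_add_cancel (x k)
theorem zmod2_oneone : (1 : ZMod 2) + 1 = 0 := by decide

section abstractYBE
variable {ι A X : Type*} [Fintype ι] [AddCommGroup A] [Module K A] [AddCommGroup X] [Module K X]

theorem shuffle (p : ι → ZMod 2) (c : ι → ι → ι → K) (G F : ι → A) (N : ι → ι → A)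
    (hc : ∀ k l j, c k l j ≠ 0 → p k = p l + p j)
    (hN : ∀ l j, ∑ k, c k l j • G k = N l j)
    (w : ZMod 2 → ZMod 2 → K) (B : ι → A →ₗ[K] A →ₗ[K] X) :
    ∑ k, ∑ l, w (p k) (p l) • B l (G k) (∑ j, c k l j • F j)
      = ∑ l, ∑ j, w (p l + p j) (p l) • B l (N l j) (F j) := by
  rw [Finset.sum_comm]
  refine Finset.sum_congr rfl fun l _ => ?_
  simp only [← hN, map_sum, map_smul, Finset.smul_sum, LinearMap.sum_apply, LinearMap.smul_apply]
  rw [Finset.sum_comm]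
  refine Finset.sum_congr rfl fun j _ => Finset.sum_congr rfl fun k _ => ?_
  by_cases h : c k l j = 0
  · simp [h]
  · rw [hc k l j h]

/-- The defect. -/
def defect (p : ι → ZMod 2) (M N : ι → ι → A) (k l : ι) : A :=
  M k l - N k l - gsign K (p k * p l) • N l k

theorem ybe_expand (mA : A →ₗ[K] A →ₗ[K] A) (γ : A →ₗ[K] A) (t f : ι → A) (p : ι → ZMod 2)
    (c : ι → ι → ι → K) (N : ι → ι → A)
    (hc : ∀ k l j, c k l j ≠ 0 → p k = p l + p j)
    (hN : ∀ l j, ∑ k, c k l j • γ (t k) = N l j)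
    (hft : ∀ k l, mA (f k) (t l) = ∑ j, c k l j • γ (f j))
    (htf : ∀ k l, mA (t l) (f k) = gsign K (p k * p l) • ∑ j, c k l j • γ (f j))
    (hff : ∀ k l, mA (f k) (f l) = 0) :
    YBESol (K := K) mA γ (Sum.elim t (fun k => -(gsign K (p k * p k)) • f k)) (Sum.elim f t)
      (Sum.elim p p) (Sum.elim p p) ↔
    (∑ k, ∑ l, gsign K (p k * p l) •
        ((defect (K := K) p (fun k l => mA (t k) (t l)) N k l ⊗ₜ[K] γ (f k)) ⊗ₜ[K] γ (f l)))
    + (∑ k, ∑ l, gsign K (p k) •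
        ((γ (f k) ⊗ₜ[K] defect (K := K) p (fun k l => mA (t k) (t l)) N k l) ⊗ₜ[K] γ (f l)))
    + (∑ k, ∑ l, gsign K (p k * p l + p k + p l) •
        ((γ (f k) ⊗ₜ[K] γ (f l)) ⊗ₜ[K] defect (K := K) p (fun k l => mA (t k) (t l)) N k l))
    = 0 := by
  have S := fun w B => shuffle (X := (A ⊗[K] A) ⊗[K] A) p c (fun k => γ (t k)) (fun k => γ (f k)) N hc hN w B
  let m3 := TensorProduct.mk K (A ⊗[K] A) A
  let m2 := TensorProduct.mk K A A
  let B1 : ι → A →ₗ[K] A →ₗ[K] (A ⊗[K] A) ⊗[K] A := fun l => m2.compr₂ (m3.flip (γ (f l)))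
  let B2 : ι → A →ₗ[K] A →ₗ[K] (A ⊗[K] A) ⊗[K] A := fun l => m3 ∘ₗ (m2.flip (γ (f l)))
  let B3 : ι → A →ₗ[K] A →ₗ[K] (A ⊗[K] A) ⊗[K] A := fun l => m3 ∘ₗ (m2 (γ (f l)))
  have a2 := S (fun _ _ => 1) B1
  have a3 := S (fun k l => gsign K (l * k) * gsign K (l * l)) B2
  have b1 := S (fun k l => gsign K (l * k) * gsign K (k * k)) (fun l => (B1 l).flip)
  have b3 := S (fun k l => gsign K (k * l) * (gsign K (k * l) * gsign K (l * l))) B3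
  have c1 := S (fun k l => gsign K (k * l) * gsign K (k * k) * gsign K (k * l))
    (fun l => (B2 l).flip)
  have c2 := S (fun k l => gsign K (k * k) * (gsign K (k * l) * gsign K (l * l)))
    (fun l => (B3 l).flip)
  rw [Finset.sum_comm] at b3 c1 c2
  rw [Finset.sum_comm (γ := ι)] at a2
  conv_rhs at a2 => rw [Finset.sum_comm]
  conv_rhs at b1 => rw [Finset.sum_comm]
  conv_rhs at c1 => rw [Finset.sum_comm]
  rw [Finset.sum_comm] at a2
  simp only [B1, B2, B3, m2, m3, LinearMap.compr₂_apply, LinearMap.flip_apply,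
    TensorProduct.mk_apply, LinearMap.comp_apply, one_smul] at a2 a3 b1 b3 c1 c2
  have hW : ∃ W : ι → ι → A, ∀ k l, ∑ j, c k l j • γ (f j) = W k l := ⟨_, fun _ _ => rfl⟩
  obtain ⟨W, hW⟩ := hW
  simp only [hW] at a2 a3 b1 b3 c1 c2 hft htf
  unfold YBESol
  simp only [Fintype.sum_sum_type, Sum.elim_inl, Sum.elim_inr, map_smul, map_neg, LinearMap.neg_apply, LinearMap.smul_apply,
    hff, hft, htf, TensorProduct.zero_tmul, TensorProduct.tmul_zero, smul_zero,
    ← TensorProduct.smul_tmul', TensorProduct.tmul_smul, Finset.sum_const_zero, 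
    zero_add, add_zero, smul_smul, neg_smul, smul_neg, neg_neg, Finset.sum_neg_distrib,
    Finset.sum_add_distrib, mul_neg, neg_mul, TensorProduct.neg_tmul, TensorProduct.tmul_neg]
  rw [a2, a3, b1, b3, c1, c2]
  apply Eq.congr _ rfl
  simp only [← Finset.sum_add_distrib, ← Finset.sum_sub_distrib, ← Finset.sum_neg_distrib,
    neg_zero, add_zero]
  refine Finset.sum_congr rfl fun k _ => Finset.sum_congr rfl fun l _ => ?_
  unfold defect
  rcases zmod2_cases (p k) with hk | hk <;> rcases zmod2_cases (p l) with hl | hl <;>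
    simp only [hk, hl, gs_zero, gs_one, zmod2_oneone, add_zero, zero_add, mul_zero, zero_mul,
      mul_one, one_mul, one_smul, neg_smul, tns, mul_neg, neg_mul, neg_neg, TensorProduct.sub_tmul,
      TensorProduct.tmul_sub, TensorProduct.neg_tmul, TensorProduct.tmul_neg] <;> abel
end abstractYBE

theorem coord_zero {n : ℕ} (gV : ZMod 2 → Submodule K V) (hgV : DirectSum.IsInternal gV)
    (b : Module.Basis (Fin n) K V) (pe : Fin n → ZMod 2) (hb : ∀ k, b k ∈ gV (pe k))
    (i : ZMod 2) (x : V) (hx : x ∈ gV i) (k : Fin n) (hk : pe k ≠ i) : b.coord k x = 0 := by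
  classical
  set y := ∑ l ∈ Finset.univ.filter (fun l => pe l ≠ i), b.repr x l • b l with hy
  have h1 : x = ∑ l ∈ Finset.univ.filter (fun l => pe l = i), b.repr x l • b l + y := by
    rw [hy, Finset.sum_filter_add_sum_filter_not, b.sum_repr]
  have hyi : y ∈ gV i := by
    have : y = x - ∑ l ∈ Finset.univ.filter (fun l => pe l = i), b.repr x l • b l :=
      eq_sub_of_add_eq' h1.symm
    rw [this]
    refine Submodule.sub_mem _ hx (Submodule.sum_mem _ fun l hl => Submodule.smul_mem _ _ ?_)
    have := hb l
    rwa [(Finset.mem_filter.1 hl).2] at this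
  have hyi' : y ∈ gV (i + 1) := by
    refine Submodule.sum_mem _ fun l hl => Submodule.smul_mem _ _ ?_
    have h := hb l
    have h2 : pe l = i + 1 := zmod2_ne _ _ (Finset.mem_filter.1 hl).2
    rwa [h2] at h
  have hdis : Disjoint (gV i) (gV (i + 1)) :=
    hgV.submodule_iSupIndep.pairwiseDisjoint (zmod2_ne_succ i)
  have hy0 : y = 0 := (Submodule.disjoint_def.1 hdis) y hyi hyi'
  have h3 := congrArg (b.coord k) hy0
  simp only [hy, map_sum, map_smul, map_zero, Module.Basis.coord_apply, Module.Basis.repr_self,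
    Finsupp.single_apply, smul_eq_mul, mul_ite, mul_one, mul_zero] at h3
  rw [Finset.sum_ite_eq'] at h3
  simpa [hk] using h3

theorem symm_even [FiniteDimensional K V] (β : V ≃ₗ[K] V) (W : Submodule K V)
    (h : ∀ v ∈ W, β v ∈ W) (v : V) (hv : v ∈ W) : β.symm v ∈ W := by
  have h1 : W.map β.toLinearMap ≤ W := by
    rintro _ ⟨w, hw, rfl⟩
    exact h w hw
  have h2 : W.map β.toLinearMap = W :=
    Submodule.eq_of_le_of_finrank_eq h1 (LinearEquiv.finrank_map_eq β W)
  rw [← h2] at hv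
  obtain ⟨w, hw, rfl⟩ := hv
  simpa using hw

/-- Evaluation map on the triple tensor product. -/
def evalT (u v : V) :
    ((J × Module.Dual K V) ⊗[K] (J × Module.Dual K V)) ⊗[K] (J × Module.Dual K V) →ₗ[K] J :=
  (TensorProduct.rid K J).toLinearMap ∘ₗ TensorProduct.map
    ((TensorProduct.rid K J).toLinearMap ∘ₗ TensorProduct.map (LinearMap.fst K J _)
      (Module.Dual.eval K V u ∘ₗ LinearMap.snd K J _))
    (Module.Dual.eval K V v ∘ₗ LinearMap.snd K J _)

theorem evalT_tmul (u v : V) (x y z : J × Module.Dual K V) :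
    evalT u v ((x ⊗ₜ[K] y) ⊗ₜ[K] z) = z.2 v • y.2 u • x.1 := by
  simp [evalT]

/-- with `T : V → J` even satisfying `T∘β = α∘T`, regarded via
`Hom(V,J) ≅ J ⊗ V*` as an element of `(J ⋉_{π⋆} V*)^{⊗2}`, the element
`r = T − σ(T)` is a super skew-symmetric solution of the super Hom-Jordan
Yang-Baxter equation in `J ⋉_{π⋆} V*` iff `T` is an O-operator associated
to `(V, π, β)`. -/
theorem T_minus_sigmaT_solution_iff_oOperator
    [FiniteDimensional K J] [FiniteDimensional K V]
    (g : ZMod 2 → Submodule K J) (hg : DirectSum.IsInternal g)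
    (m : J →ₗ[K] J →ₗ[K] J) (α : J ≃ₗ[K] J)
    (hJ : IsMultHomJordan g m α.toLinearMap)
    (gV : ZMod 2 → Submodule K V) (hgV : DirectSum.IsInternal gV)
    (π : J →ₗ[K] Module.End K V) (β : V ≃ₗ[K] V)
    (hrep : IsRep g m α.toLinearMap gV π β.toLinearMap)
    (πs : J →ₗ[K] Module.End K (Module.Dual K V))
    (hπs : ∀ i j : ZMod 2, ∀ x ∈ g i, ∀ ξ ∈ dualGrading gV j, ∀ u : V,
      πs x ξ u = gsign K (i * j) * ξ (π (α.symm x) (β.symm (β.symm u))))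
    (m' : (J × Module.Dual K V) →ₗ[K] (J × Module.Dual K V) →ₗ[K] (J × Module.Dual K V))
    (hm' : IsSemidirectMul g (dualGrading gV) m πs m')
    (T : V →ₗ[K] J) (hTe : ∀ i : ZMod 2, ∀ v ∈ gV i, T v ∈ g i)
    (hTβ : ∀ v : V, T (β v) = α (T v))
    (n : ℕ) (b : Module.Basis (Fin n) K V) (pe : Fin n → ZMod 2)
    (hb : ∀ k, b k ∈ gV (pe k)) :
    (SkewSol (K := K) (rX T b pe) (rY T b) (rP pe) (rP pe) ∧
      YBESol (K := K) m' (α.toLinearMap.prodMap β.symm.toLinearMap.dualMap)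
        (rX T b pe) (rY T b) (rP pe) (rP pe)) ↔
    IsOOperator g m α.toLinearMap gV π β.toLinearMap T := by
  classical
  have hα : ∀ u, α.symm (T u) = T (β.symm u) := by
    intro u
    rw [LinearEquiv.symm_apply_eq, ← hTβ, LinearEquiv.apply_symm_apply]
  have hβπ : ∀ x v, β (π x v) = π (α x) (β v) := fun x v =>
    LinearMap.congr_fun (hrep.2.2.1 x) v
  have hβπ' : ∀ x v, β.symm (π x v) = π (α.symm x) (β.symm v) := by
    intro x v
    rw [LinearEquiv.symm_apply_eq, hβπ]
    simp
  have hcz := coord_zero gV hgV b pe hb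
  have hco : ∀ k, b.coord k ∈ dualGrading gV (pe k) := fun k x hx =>
    hcz _ x hx k (by generalize pe k = a; revert a; decide)
  have hgs : ∀ e : ZMod 2, gsign K e * gsign K e = 1 := by
    intro e
    rcases zmod2_cases e with h | h <;> simp [h, gs_zero, gs_one]
  have hπb : ∀ k l, gsign K (pe k * pe l) • πs (T (b l)) (b.coord k) =
      ∑ j, b.coord k (β.symm (π (T (b l)) (b j))) • β.symm.toLinearMap.dualMap (b.coord j) := by
    intro k l
    refine (b.map β).ext fun i => ?_
    have h := hπs _ _ _ (hTe _ _ (hb l)) _ (hco k) (β (b i))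
    simp only [Module.Basis.map_apply, LinearMap.smul_apply, h, LinearMap.sum_apply,
      LinearMap.dualMap_apply, LinearEquiv.coe_coe, LinearEquiv.symm_apply_apply, hβπ',
      smul_eq_mul, Module.Basis.coord_apply, Module.Basis.repr_self, Finsupp.single_apply]
    rw [← mul_assoc, mul_comm (pe l), hgs]
    simp
  have E := ybe_expand (K := K) m' (α.toLinearMap.prodMap β.symm.toLinearMap.dualMap)
    (fun k => (T (b k), (0 : Module.Dual K V))) (fun k => ((0 : J), b.coord k)) pe
    (fun k l j => b.coord k (β.symm (π (T (b l)) (b j))))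
    (fun l j => (T (π (T (b l)) (b j)), 0))
    (by
      intro k l j h
      by_contra hne
      refine h (hcz (pe l + pe j) _ (symm_even β _ (hrep.2.1 _) _ ?_) k hne)
      exact hrep.1 _ _ _ (hTe _ _ (hb l)) _ (hb j))
    (by
      intro l j
      refine Prod.ext ?_ ?_
      · simp only [LinearMap.prodMap_apply, Prod.fst_sum, Prod.smul_fst]
        have := b.sum_repr (β.symm (π (T (b l)) (b j)))
        have h2 := congrArg (fun x => α (T x)) this
        simp only [map_sum, map_smul] at h2
        simp only [Module.Basis.coord_apply, LinearEquiv.coe_coe]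
        rw [h2, ← hTβ, LinearEquiv.apply_symm_apply]
      · simp [Prod.snd_sum])
    (by
      intro k l
      rw [hm' (pe k) (pe l) 0 (Submodule.zero_mem _) _ (hco k) _ (hTe _ _ (hb l)) 0
        (Submodule.zero_mem _)]
      refine Prod.ext ?_ ?_
      · simp [Prod.fst_sum]
      · simp only [Prod.snd_sum, Prod.smul_snd, LinearMap.prodMap_apply, map_zero, zero_add]
        exact hπb k l)
    (by
      intro k l
      rw [hm' (pe l) (pe k) _ (hTe _ _ (hb l)) 0 (Submodule.zero_mem _) 0 (Submodule.zero_mem _)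
        _ (hco k)]
      refine Prod.ext ?_ ?_
      · simp [Prod.fst_sum]
      · simp only [Prod.snd_sum, Prod.smul_snd, LinearMap.prodMap_apply, map_zero, smul_zero,
          add_zero]
        rw [← hπb k l, smul_smul, hgs, one_smul])
    (by
      intro k l
      rw [hm' (pe k) (pe l) 0 (Submodule.zero_mem _) _ (hco k) 0 (Submodule.zero_mem _) _ (hco l)]
      simp)
  have hY : YBESol (K := K) m' (α.toLinearMap.prodMap β.symm.toLinearMap.dualMap)
      (rX T b pe) (rY T b) (rP pe) (rP pe) ↔ _ := E
  rw [hY]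
  clear hY E
  have hD : ∀ k l, defect (K := K) pe (fun k l => m' (T (b k), (0 : Module.Dual K V)) (T (b l), 0))
      (fun l j => (T (π (T (b l)) (b j)), (0 : Module.Dual K V))) k l =
      (m (T (b k)) (T (b l)) - T (π (T (b k)) (b l))
        - gsign K (pe k * pe l) • T (π (T (b l)) (b k)), 0) := by
    intro k l
    unfold defect
    dsimp only
    rw [hm' (pe k) (pe l) _ (hTe _ _ (hb k)) 0 (Submodule.zero_mem _) _ (hTe _ _ (hb l)) 0
        (Submodule.zero_mem _)]
    simp
  simp only [hD]
  constructor
  · rintro ⟨-, h⟩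
    have hz : ∀ k l, m (T (b k)) (T (b l)) - T (π (T (b k)) (b l))
        - gsign K (pe k * pe l) • T (π (T (b l)) (b k)) = 0 := by
      intro k l
      have h2 := congrArg (evalT (β (b k)) (β (b l))) h
      simp only [map_add, map_sum, map_smul, evalT_tmul, LinearMap.prodMap_apply, map_zero,
        smul_zero, LinearMap.zero_apply, zero_smul, Finset.sum_const_zero, add_zero,
        LinearMap.dualMap_apply, LinearEquiv.coe_coe, LinearEquiv.symm_apply_apply,
        Module.Basis.coord_apply, Module.Basis.repr_self, Finsupp.single_apply, ite_smul,
        one_smul, smul_ite, Finset.sum_ite_irrel, Finset.sum_ite_eq, Finset.mem_univ, if_true] at h2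
      have h3 := congrArg (fun x => gsign K (pe k * pe l) • x) h2
      simpa only [smul_smul, hgs, one_smul, smul_zero] using h3
    refine ⟨hTe, fun v => (hTβ v).symm, ?_⟩
    intro i j u hu v hv
    rw [← sub_eq_zero, map_add, map_smul, ← sub_sub]
    rw [← b.sum_repr u, ← b.sum_repr v]
    simp only [map_sum, map_smul, LinearMap.sum_apply, LinearMap.smul_apply, Finset.smul_sum]
    rw [Finset.sum_comm (f := fun x y => gsign K (i * j) • _)]
    simp only [← Finset.sum_sub_distrib]
    refine Finset.sum_eq_zero fun l _ => Finset.sum_eq_zero fun k _ => ?_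
    by_cases hk : pe k = i
    · by_cases hl : pe l = j
      · subst hk hl
        linear_combination (norm := module) (b.repr u k * b.repr v l) • hz k l
      · have h0 : b.repr v l = 0 := hcz j v hv l hl
        simp [h0]
    · have h0 : b.repr u k = 0 := hcz i u hu k hk
      simp [h0]
  · intro hO
    constructor
    · unfold SkewSol
      have e1 : ∀ k, gsign K (pe k * pe k) • ((T (b k), (0 : Module.Dual K V)) ⊗ₜ[K]
          (-(gsign K (pe k * pe k)) • ((0 : J), b.coord k))) =
          -((T (b k), (0 : Module.Dual K V)) ⊗ₜ[K] ((0 : J), b.coord k)) := by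
        intro k
        rw [TensorProduct.tmul_smul, smul_smul, mul_neg, hgs, tns, one_smul]
      have e2 : ∀ k, (-(gsign K (pe k * pe k)) • ((0 : J), b.coord k)) ⊗ₜ[K]
          (T (b k), (0 : Module.Dual K V)) =
          -(gsign K (pe k * pe k) • (((0 : J), b.coord k) ⊗ₜ[K]
            (T (b k), (0 : Module.Dual K V)))) := by
        intro k
        rw [← TensorProduct.smul_tmul', tns]
      simp only [Fintype.sum_sum_type, rX, rY, rP, Sum.elim_inl, Sum.elim_inr, e1, e2]
      rw [tsn, tsn]
      abel
    · have hz : ∀ k l, m (T (b k)) (T (b l)) - T (π (T (b k)) (b l))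
          - gsign K (pe k * pe l) • T (π (T (b l)) (b k)) = 0 := by
        intro k l
        rw [hO.2.2 _ _ _ (hb k) _ (hb l), map_add, map_smul]
        abel
      simp only [hz, Prod.mk_zero_zero, TensorProduct.zero_tmul, TensorProduct.tmul_zero,
        smul_zero, Finset.sum_const_zero, add_zero]
end
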